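/- Fix n, m, q, p ∈ ℕ with q ≥ 1, matrices A ∈ ℝ^{n×n}, B ∈ ℝ^{n×m}, C ∈ ℝ^{q×n} of full row rank, N ∈ ℝ^{p×q}, H := N C, a mean μ₀ ∈ ℝⁿ, and symmetric positive definite matrices Σ₀, Q ∈ ℝ^{n×n}. Define the Kalman covariance recursion: P̂(0) = Σ₀; K(t) = P̂(t) Cᵀ (C P̂(t) Cᵀ)⁻¹, P̄(t) = P̂(t) − K(t) C P̂(t), P̂(t+1) = A P̄(t) Aᵀ + Q. Fix a horizon T ∈ ℕ and an input sequence u(0), …, u(T−1) ∈ ℝᵐ. Let μ_M be the pushforward of the product Gaussian measure N(μ₀, Σ₀) ⊗ (⨂_{t=0}^{T−1} N(0, Q)) on ℝⁿ × (ℝⁿ)^T under the measurable map sending (ξ, w) to the output trajectory (H x(0), …, H x(T)) of the recursion x(0) = ξ, x(t+1) = A x(t) + B u(t) + w(t). Let μ_M̄ be the pushforward of the product Gaussian measure N(μ₀, Σ₀) ⊗ (⨂_{t=1}^{T} N(0, C P̂(t) Cᵀ)) on ℝⁿ × (ℝ^q)^T under the map sending (ξ, v) to the trajectory (H x̄(0),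 …, H x̄(T)) of the recursion x̄(0) = μ₀ + K(0) C (ξ − μ₀), x̄(t+1) = A x̄(t) + B u(t) + K(t+1) v(t+1). Then μ_M = μ_M̄ as measures on (ℝᵖ)^{T+1}. -/

import Mathlib

open MeasureTheory ProbabilityTheory Matrix

/-- A measure `μ` on `ℝ^d` is Gaussian with mean `m` and covariance `S` if every
one-dimensional projection `x ↦ a ⬝ᵥ x` pushes it to the one-dimensional Gaussian
`N(a ⬝ᵥ m, aᵀ S a)` (variance `0` giving a Dirac mass). -/
def IsGaussianVec {d : ℕ} (μ : Measure (Fin d → ℝ)) (m : Fin d → ℝ)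
    (S : Matrix (Fin d) (Fin d) ℝ) : Prop :=
  ∀ a : Fin d → ℝ,
    μ.map (fun x => a ⬝ᵥ x) = gaussianReal (a ⬝ᵥ m) (Real.toNNReal (a ⬝ᵥ S.mulVec a))

/-- The a priori Kalman covariance recursion: `P̂ 0 = Σ₀` and
`P̂ (t+1) = A * (P̂ t - P̂ t * Cᵀ * (C * P̂ t * Cᵀ)⁻¹ * C * P̂ t) * Aᵀ + Q`. -/
noncomputable def kalmanPhat {n q : ℕ} (A : Matrix (Fin n) (Fin n) ℝ)
    (C : Matrix (Fin q) (Fin n) ℝ) (Q S0 : Matrix (Fin n) (Fin n) ℝ) :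
    ℕ → Matrix (Fin n) (Fin n) ℝ
  | 0 => S0
  | t + 1 =>
      A * (kalmanPhat A C Q S0 t -
            kalmanPhat A C Q S0 t * Cᵀ * (C * kalmanPhat A C Q S0 t * Cᵀ)⁻¹ *
              (C * kalmanPhat A C Q S0 t)) * Aᵀ + Q

/-- The Kalman gain `K t = P̂ t * Cᵀ * (C * P̂ t * Cᵀ)⁻¹`. -/
noncomputable def kalmanK {n q : ℕ} (A : Matrix (Fin n) (Fin n) ℝ)
    (C : Matrix (Fin q) (Fin n) ℝ) (Q S0 : Matrix (Fin n) (Fin n) ℝ) (t : ℕ) :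
    Matrix (Fin n) (Fin q) ℝ :=
  kalmanPhat A C Q S0 t * Cᵀ * (C * kalmanPhat A C Q S0 t * Cᵀ)⁻¹

/-- State trajectory of the linear recursion `x 0 = ξ`,
`x (t+1) = A * x t + B * u t + e t`. -/
def olState {n m : ℕ} (A : Matrix (Fin n) (Fin n) ℝ) (B : Matrix (Fin n) (Fin m) ℝ)
    (u : ℕ → Fin m → ℝ) (e : ℕ → Fin n → ℝ) (ξ : Fin n → ℝ) : ℕ → Fin n → ℝ
  | 0 => ξ
  | t + 1 => A.mulVec (olState A B u e ξ t) + B.mulVec (u t) + e t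

/-- Extension of a finite sequence `Fin T → α` to `ℕ → α` by zero. -/
def extFin {T : ℕ} {α : Type*} [Zero α] (w : Fin T → α) (t : ℕ) : α :=
  if h : t < T then w ⟨t, h⟩ else 0


theorem kal_S_posDef {n q : ℕ} (C : Matrix (Fin q) (Fin n) ℝ) (hC : C.rank = q)
    (P : Matrix (Fin n) (Fin n) ℝ) (hP : P.PosDef) : (C * P * Cᵀ).PosDef := by
  have h1 : LinearIndependent ℝ C.row := by
    rw [linearIndependent_iff_card_eq_finrank_span, Set.finrank, ← Matrix.rank_eq_finrank_span_row, hC]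
    simp
  have h2 : Function.Injective C.vecMul := Matrix.vecMul_injective_iff.2 h1
  have := hP.mul_mul_conjTranspose_same h2
  simpa [conjTranspose_eq_transpose_of_trivial] using this

theorem kal_CK {n q : ℕ} (C : Matrix (Fin q) (Fin n) ℝ) (P : Matrix (Fin n) (Fin n) ℝ)
    (hS : (C * P * Cᵀ).PosDef) :
    (P - P * Cᵀ * (C * P * Cᵀ)⁻¹ * (C * P)) * Cᵀ = 0 := by
  have hu : IsUnit (C * P * Cᵀ).det := (Matrix.isUnit_iff_isUnit_det _).1 hS.isUnit
  rw [Matrix.sub_mul, Matrix.mul_assoc _ (C * P) Cᵀ, Matrix.mul_assoc _ (_)⁻¹ _,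
    Matrix.nonsing_inv_mul _ hu]
  simp

theorem kal_KSK {n q : ℕ} (C : Matrix (Fin q) (Fin n) ℝ) (P : Matrix (Fin n) (Fin n) ℝ)
    (hP : P.PosDef) (hS : (C * P * Cᵀ).PosDef) :
    (P * Cᵀ * (C * P * Cᵀ)⁻¹) * (C * P * Cᵀ) * (P * Cᵀ * (C * P * Cᵀ)⁻¹)ᵀ =
      P * Cᵀ * (C * P * Cᵀ)⁻¹ * (C * P) := by
  have hu : IsUnit (C * P * Cᵀ).det := (Matrix.isUnit_iff_isUnit_det _).1 hS.isUnit
  have hPt : Pᵀ = P := by simpa [IsHermitian, conjTranspose_eq_transpose_of_trivial] using hP.1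
  have hSt : (C * P * Cᵀ)ᵀ = C * P * Cᵀ := by
    simpa [IsHermitian, conjTranspose_eq_transpose_of_trivial] using hS.1
  have e : (P * Cᵀ * (C * P * Cᵀ)⁻¹)ᵀ = (C * P * Cᵀ)⁻¹ * (C * P) := by
    rw [Matrix.transpose_mul, Matrix.transpose_nonsing_inv, hSt, Matrix.transpose_mul, hPt,
      Matrix.transpose_transpose]
  rw [e, Matrix.mul_assoc _ (_)⁻¹ (C * P * Cᵀ), Matrix.nonsing_inv_mul _ hu, Matrix.mul_one,
    Matrix.mul_assoc _ (_)⁻¹ (C * P)]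

theorem kal_Pbar_psd {n q : ℕ} (C : Matrix (Fin q) (Fin n) ℝ) (P : Matrix (Fin n) (Fin n) ℝ)
    (hP : P.PosDef) (hS : (C * P * Cᵀ).PosDef) :
    (P - P * Cᵀ * (C * P * Cᵀ)⁻¹ * (C * P)).PosSemidef := by
  have h := hP.posSemidef.mul_mul_conjTranspose_same (1 - P * Cᵀ * (C * P * Cᵀ)⁻¹ * C)
  have h0 := kal_CK C P hS
  convert h using 1
  rw [conjTranspose_eq_transpose_of_trivial, Matrix.transpose_sub, Matrix.mul_sub,
    Matrix.transpose_mul, ← Matrix.mul_assoc _ Cᵀ, Matrix.sub_mul 1, Matrix.one_mul,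
    Matrix.mul_assoc _ C P, h0]
  simp

theorem kalmanPhat_posDef {n q : ℕ} (A : Matrix (Fin n) (Fin n) ℝ)
    (C : Matrix (Fin q) (Fin n) ℝ) (hC : C.rank = q) (Q S0 : Matrix (Fin n) (Fin n) ℝ)
    (hS0 : S0.PosDef) (hQ : Q.PosDef) (t : ℕ) : (kalmanPhat A C Q S0 t).PosDef := by
  induction t with
  | zero => exact hS0
  | succ t ih =>
    have h := (kal_Pbar_psd C _ ih (kal_S_posDef C hC _ ih)).mul_mul_conjTranspose_same A
    rw [conjTranspose_eq_transpose_of_trivial] at h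
    exact Matrix.PosDef.posSemidef_add h hQ

theorem gaussVec_charFun {d : ℕ} (μ : Measure (Fin d → ℝ)) (m : Fin d → ℝ)
    (S : Matrix (Fin d) (Fin d) ℝ) (hS : S.PosSemidef) (h : IsGaussianVec μ m S)
    (a : Fin d → ℝ) :
    ∫ x, Complex.exp ((a ⬝ᵥ x : ℝ) * Complex.I) ∂μ =
      Complex.exp ((a ⬝ᵥ m : ℝ) * Complex.I - ((a ⬝ᵥ S *ᵥ a : ℝ) : ℂ) / 2) := by
  have h1 := charFun_gaussianReal (μ := a ⬝ᵥ m) (v := Real.toNNReal (a ⬝ᵥ S.mulVec a)) 1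
  rw [← h a, charFun_apply_real, integral_map (by fun_prop) (by fun_prop)] at h1
  have hn : 0 ≤ a ⬝ᵥ S *ᵥ a := by simpa using hS.dotProduct_mulVec_nonneg a
  have h2 : (((a ⬝ᵥ S *ᵥ a).toNNReal : ℝ) : ℂ) = ((a ⬝ᵥ S *ᵥ a : ℝ) : ℂ) := by
    rw [Real.coe_toNNReal _ hn]
  rw [h2] at h1
  simpa using h1

theorem prod_charFun {n q T : ℕ} (γ : Measure (Fin n → ℝ)) [IsProbabilityMeasure γ]
    (ν : Fin T → Measure (Fin q → ℝ)) [∀ i, IsProbabilityMeasure (ν i)]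
    (m : Fin n → ℝ) (S : Matrix (Fin n) (Fin n) ℝ) (hS : S.PosSemidef)
    (h : IsGaussianVec γ m S)
    (R : Fin T → Matrix (Fin q) (Fin q) ℝ) (hR : ∀ i, (R i).PosSemidef)
    (hν : ∀ i, IsGaussianVec (ν i) 0 (R i))
    (a : Fin n → ℝ) (b : Fin T → Fin q → ℝ) (c : ℝ) :
    ∫ x, Complex.exp (((a ⬝ᵥ x.1 + ∑ i, b i ⬝ᵥ x.2 i + c : ℝ) : ℂ) * Complex.I)
      ∂(γ.prod (Measure.pi ν)) =
    Complex.exp (((a ⬝ᵥ m + c : ℝ) : ℂ) * Complex.I -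
      ((a ⬝ᵥ S *ᵥ a + ∑ i, b i ⬝ᵥ (R i) *ᵥ b i : ℝ) : ℂ) / 2) := by
  have e : ∀ x : (Fin n → ℝ) × (Fin T → Fin q → ℝ),
      Complex.exp (((a ⬝ᵥ x.1 + ∑ i, b i ⬝ᵥ x.2 i + c : ℝ) : ℂ) * Complex.I) =
      (Complex.exp (c * Complex.I) * Complex.exp ((a ⬝ᵥ x.1 : ℝ) * Complex.I)) *
        ∏ i, Complex.exp ((b i ⬝ᵥ x.2 i : ℝ) * Complex.I) := by
    intro x
    rw [← Complex.exp_sum, ← Complex.exp_add, ← Complex.exp_add, ← Finset.sum_mul]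
    congr 1
    push_cast
    ring
  simp_rw [e]
  rw [integral_prod_mul (fun x : Fin n → ℝ =>
      Complex.exp (c * Complex.I) * Complex.exp ((a ⬝ᵥ x : ℝ) * Complex.I))
      (fun y : Fin T → Fin q → ℝ => ∏ i, Complex.exp ((b i ⬝ᵥ y i : ℝ) * Complex.I)),
    integral_const_mul, gaussVec_charFun γ m S hS h,
    integral_fintype_prod_eq_prod
      (f := fun i (y : Fin q → ℝ) => Complex.exp ((b i ⬝ᵥ y : ℝ) * Complex.I))]
  simp_rw [fun i => gaussVec_charFun (ν i) 0 (R i) (hR i) (hν i)]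
  rw [← Complex.exp_sum, ← Complex.exp_add, ← Complex.exp_add]
  congr 1
  simp only [dotProduct_zero, Complex.ofReal_zero, zero_mul, zero_sub, Finset.sum_neg_distrib,
    ← Finset.sum_div]
  push_cast
  ring

/-- Costate recursion, indexed backwards. -/
def costate {n : ℕ} (A : Matrix (Fin n) (Fin n) ℝ) (T : ℕ) (h : ℕ → Fin n → ℝ) :
    ℕ → Fin n → ℝ
  | 0 => 0
  | k + 1 => h (T - k) + Aᵀ *ᵥ costate A T h k

theorem exists_costate {n : ℕ} (A : Matrix (Fin n) (Fin n) ℝ) (T : ℕ) (h : ℕ → Fin n → ℝ) :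
    ∃ l : ℕ → Fin n → ℝ, l (T + 1) = 0 ∧ ∀ t ≤ T, l t = h t + Aᵀ *ᵥ l (t + 1) := by
  refine ⟨fun t => costate A T h (T + 1 - t), by simp [costate], fun t ht => ?_⟩
  have e1 : T + 1 - t = (T - t) + 1 := by omega
  have e2 : T + 1 - (t + 1) = T - t := by omega
  have e3 : T - (T - t) = t := by omega
  simp only [e1, e2, costate, e3]

theorem olState_sum {n m : ℕ} (A : Matrix (Fin n) (Fin n) ℝ) (B : Matrix (Fin n) (Fin m) ℝ)
    (u : ℕ → Fin m → ℝ) (e : ℕ → Fin n → ℝ) (ξ : Fin n → ℝ) (T : ℕ) (h l : ℕ → Fin n → ℝ)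
    (hl : ∀ t ≤ T, l t = h t + Aᵀ *ᵥ l (t + 1)) (k : ℕ) (hk : k ≤ T) :
    ∑ s ∈ Finset.range (k + 1), h s ⬝ᵥ olState A B u e ξ s +
      (Aᵀ *ᵥ l (k + 1)) ⬝ᵥ olState A B u e ξ k =
    l 0 ⬝ᵥ ξ + ∑ t ∈ Finset.range k, l (t + 1) ⬝ᵥ (B *ᵥ u t + e t) := by
  induction k with
  | zero =>
    rw [hl 0 hk, add_dotProduct]
    simp [olState]
  | succ k ih =>
    have ih := ih (by omega)
    have key : l (k + 1) ⬝ᵥ olState A B u e ξ (k + 1) =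
        (Aᵀ *ᵥ l (k + 1)) ⬝ᵥ olState A B u e ξ k + l (k + 1) ⬝ᵥ (B *ᵥ u k + e k) := by
      rw [olState, add_assoc, dotProduct_add, dotProduct_mulVec, ← mulVec_transpose]
    have key2 := congrArg (· ⬝ᵥ olState A B u e ξ (k + 1)) (hl (k + 1) hk)
    simp only [add_dotProduct] at key2
    rw [Finset.sum_range_succ _ (k + 1), Finset.sum_range_succ (fun t => l (t + 1) ⬝ᵥ _) k]
    linarith

theorem kal_energy {n q : ℕ} (A : Matrix (Fin n) (Fin n) ℝ)
    (C : Matrix (Fin q) (Fin n) ℝ) (hC : C.rank = q) (Q S0 : Matrix (Fin n) (Fin n) ℝ)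
    (hS0 : S0.PosDef) (hQ : Q.PosDef) (T : ℕ) (a : ℕ → Fin q → ℝ) (l : ℕ → Fin n → ℝ)
    (hl : ∀ t ≤ T, l t = Cᵀ *ᵥ a t + Aᵀ *ᵥ l (t + 1)) (k : ℕ) (hk : k ≤ T) :
    l 0 ⬝ᵥ S0 *ᵥ l 0 + ∑ t ∈ Finset.range k, l (t + 1) ⬝ᵥ Q *ᵥ l (t + 1) =
    ∑ t ∈ Finset.range (k + 1), ((kalmanK A C Q S0 t)ᵀ *ᵥ l t) ⬝ᵥ
        (C * kalmanPhat A C Q S0 t * Cᵀ) *ᵥ ((kalmanK A C Q S0 t)ᵀ *ᵥ l t) +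
      (Aᵀ *ᵥ l (k + 1)) ⬝ᵥ (kalmanPhat A C Q S0 k -
            kalmanPhat A C Q S0 k * Cᵀ * (C * kalmanPhat A C Q S0 k * Cᵀ)⁻¹ *
              (C * kalmanPhat A C Q S0 k)) *ᵥ (Aᵀ *ᵥ l (k + 1)) := by
  have main : ∀ t ≤ T, l t ⬝ᵥ kalmanPhat A C Q S0 t *ᵥ l t =
      ((kalmanK A C Q S0 t)ᵀ *ᵥ l t) ⬝ᵥ
        (C * kalmanPhat A C Q S0 t * Cᵀ) *ᵥ ((kalmanK A C Q S0 t)ᵀ *ᵥ l t) +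
      (Aᵀ *ᵥ l (t + 1)) ⬝ᵥ (kalmanPhat A C Q S0 t -
            kalmanPhat A C Q S0 t * Cᵀ * (C * kalmanPhat A C Q S0 t * Cᵀ)⁻¹ *
              (C * kalmanPhat A C Q S0 t)) *ᵥ (Aᵀ *ᵥ l (t + 1)) := by
    intro t ht
    have hP := kalmanPhat_posDef A C hC Q S0 hS0 hQ t
    have hS := kal_S_posDef C hC _ hP
    have h1 := kal_KSK C _ hP hS
    have h2 := kal_CK C _ hS
    have h3 := kal_Pbar_psd C _ hP hS
    have e1 : ((kalmanK A C Q S0 t)ᵀ *ᵥ l t) ⬝ᵥ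
        (C * kalmanPhat A C Q S0 t * Cᵀ) *ᵥ ((kalmanK A C Q S0 t)ᵀ *ᵥ l t) =
        l t ⬝ᵥ (kalmanPhat A C Q S0 t * Cᵀ * (C * kalmanPhat A C Q S0 t * Cᵀ)⁻¹ *
              (C * kalmanPhat A C Q S0 t)) *ᵥ l t := by
      rw [← h1, mulVec_transpose, ← dotProduct_mulVec, ← mulVec_transpose, mulVec_mulVec,
        mulVec_mulVec]
      congr 2
    rw [e1]
    generalize hX : kalmanPhat A C Q S0 t -
            kalmanPhat A C Q S0 t * Cᵀ * (C * kalmanPhat A C Q S0 t * Cᵀ)⁻¹ *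
              (C * kalmanPhat A C Q S0 t) = X at h2 h3 ⊢
    have hXt : Xᵀ = X := by
      simpa [IsHermitian, conjTranspose_eq_transpose_of_trivial] using h3.1
    have e2 : X *ᵥ (Aᵀ *ᵥ l (t + 1)) = X *ᵥ l t := by
      rw [hl t ht, mulVec_add, mulVec_mulVec _ X Cᵀ, h2]; simp
    have e3 : (Aᵀ *ᵥ l (t + 1)) ⬝ᵥ X *ᵥ l t = l t ⬝ᵥ X *ᵥ l t := by
      rw [dotProduct_mulVec, ← mulVec_transpose, hXt, e2, dotProduct_comm]
      
    rw [e2, e3, ← dotProduct_add, ← add_mulVec, ← hX]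
    simp
  induction k with
  | zero =>
    have := main 0 hk
    simpa [kalmanPhat] using this
  | succ k ih =>
    have ih := ih (by omega)
    have h1 := main (k + 1) hk
    rw [Finset.sum_range_succ, ← add_assoc, ih, Finset.sum_range_succ _ (k + 1), add_assoc, add_assoc,
      ← h1, kalmanPhat, add_mulVec, dotProduct_add]
    congr 2
    rw [mulVec_transpose, ← dotProduct_mulVec, ← mulVec_transpose, mulVec_mulVec, mulVec_mulVec,
      ← Matrix.mul_assoc]

theorem olState_continuous {X : Type*} [TopologicalSpace X] {n m : ℕ}
    (A : Matrix (Fin n) (Fin n) ℝ) (B : Matrix (Fin n) (Fin m) ℝ)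
    (u : ℕ → Fin m → ℝ) (e : X → ℕ → Fin n → ℝ) (ξ : X → Fin n → ℝ)
    (he : ∀ t, Continuous fun x => e x t) (hξ : Continuous ξ) (t : ℕ) :
    Continuous fun x => olState A B u (e x) (ξ x) t := by
  induction t with
  | zero => exact hξ
  | succ t ih =>
    have h1 : Continuous fun x => A *ᵥ olState A B u (e x) (ξ x) t :=
      Continuous.matrix_mulVec continuous_const ih
    exact (h1.add continuous_const).add (he t)

theorem extFin_continuous {T d : ℕ} (t : ℕ) :
    Continuous fun w : Fin T → Fin d → ℝ => extFin w t := by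
  unfold extFin
  split_ifs with h
  · exact continuous_apply _
  · exact continuous_const

/-- **The original model and the abstract model have the same output distribution**
(the lemma in the appendix of the paper, used in Theorem 1), in finite horizon `T`, for a
fixed (open-loop) input sequence `u`.  `γ0 = N(μ₀, Σ₀)` is the law of the initial state,
`γw = N(0, Q)` the law of each process noise `w t`, and `ν i = N(0, C * P̂ (i+1) * Cᵀ)`
the law of the innovation `v (i+1)`; the abstract model is initialized at
`x̄ 0 = μ₀ + K 0 * C * (ξ - μ₀)` and driven by `x̄ (t+1) = A * x̄ t + B * u t + K (t+1) * v (t+1)`,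
while the original model is `x 0 = ξ`, `x (t+1) = A * x t + B * u t + w t`, with outputs
`H * x t` for `H = N * C`. -/
theorem original_eq_abstract_output_law {n m q p : ℕ} (hq : 1 ≤ q)
    (A : Matrix (Fin n) (Fin n) ℝ) (B : Matrix (Fin n) (Fin m) ℝ)
    (C : Matrix (Fin q) (Fin n) ℝ) (hC : C.rank = q)
    (N : Matrix (Fin p) (Fin q) ℝ)
    (μ0 : Fin n → ℝ) (S0 Q : Matrix (Fin n) (Fin n) ℝ)
    (hS0 : S0.PosDef) (hQ : Q.PosDef)
    (T : ℕ) (u : ℕ → Fin m → ℝ)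
    (γ0 : Measure (Fin n → ℝ)) [IsProbabilityMeasure γ0]
    (hγ0 : IsGaussianVec γ0 μ0 S0)
    (γw : Measure (Fin n → ℝ)) [IsProbabilityMeasure γw]
    (hγw : IsGaussianVec γw 0 Q)
    (ν : Fin T → Measure (Fin q → ℝ)) [∀ i, IsProbabilityMeasure (ν i)]
    (hν : ∀ i : Fin T, IsGaussianVec (ν i) 0 (C * kalmanPhat A C Q S0 (i.1 + 1) * Cᵀ)) :
    (γ0.prod (Measure.pi fun _ : Fin T => γw)).map
        (fun ξw : (Fin n → ℝ) × (Fin T → Fin n → ℝ) =>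
          fun i : Fin (T + 1) => (N * C).mulVec (olState A B u (extFin ξw.2) ξw.1 i)) =
      (γ0.prod (Measure.pi fun i : Fin T => ν i)).map
        (fun ξv : (Fin n → ℝ) × (Fin T → Fin q → ℝ) =>
          fun i : Fin (T + 1) =>
            (N * C).mulVec
              (olState A B u
                (fun t => (kalmanK A C Q S0 (t + 1)).mulVec (extFin ξv.2 t))
                (μ0 + (kalmanK A C Q S0 0).mulVec (C.mulVec (ξv.1 - μ0))) i)) := by
  have hcont1 : Continuous (fun ξw : (Fin n → ℝ) × (Fin T → Fin n → ℝ) =>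
          fun i : Fin (T + 1) => (N * C).mulVec (olState A B u (extFin ξw.2) ξw.1 i)) := by
    refine continuous_pi fun i => Continuous.matrix_mulVec continuous_const ?_
    exact olState_continuous A B u _ _ (fun t => (extFin_continuous t).comp continuous_snd)
      continuous_fst _
  have hcont2 : Continuous (fun ξv : (Fin n → ℝ) × (Fin T → Fin q → ℝ) =>
          fun i : Fin (T + 1) =>
            (N * C).mulVec
              (olState A B u
                (fun t => (kalmanK A C Q S0 (t + 1)).mulVec (extFin ξv.2 t))
                (μ0 + (kalmanK A C Q S0 0).mulVec (C.mulVec (ξv.1 - μ0))) i)) := by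
    refine continuous_pi fun i => Continuous.matrix_mulVec continuous_const ?_
    refine olState_continuous A B u _ _ (fun t => Continuous.matrix_mulVec continuous_const
      ((extFin_continuous t).comp continuous_snd)) ?_ _
    exact continuous_const.add (Continuous.matrix_mulVec continuous_const
      (Continuous.matrix_mulVec continuous_const (continuous_fst.sub continuous_const)))
  have := Measure.isProbabilityMeasure_map (μ := γ0.prod (Measure.pi fun _ : Fin T => γw))
    hcont1.measurable.aemeasurable
  have := Measure.isProbabilityMeasure_map (μ := γ0.prod (Measure.pi fun i : Fin T => ν i))
    hcont2.measurable.aemeasurable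
  apply Measure.ext_of_charFunDual
  ext L
  rw [charFunDual_apply, charFunDual_apply,
    integral_map hcont1.measurable.aemeasurable (by fun_prop),
    integral_map hcont2.measurable.aemeasurable (by fun_prop)]
  -- coordinates of the functional
  let g : Fin (T + 1) → Fin p → ℝ := fun i j => L (Pi.single i (Pi.single j 1))
  have hL : ∀ y : Fin (T + 1) → Fin p → ℝ, L y = ∑ i, g i ⬝ᵥ y i := by
    intro y
    have hy : y = ∑ i, ∑ j, y i j • (Pi.single i (Pi.single j (1 : ℝ)) :
        Fin (T + 1) → Fin p → ℝ) := by
      ext i j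
      simp [Finset.sum_apply, Pi.single_apply, apply_ite, ite_apply]
    conv_lhs => rw [hy]
    simp [dotProduct, g, mul_comm]
  let a : ℕ → Fin q → ℝ := fun s => if h : s < T + 1 then Nᵀ *ᵥ g ⟨s, h⟩ else 0
  obtain ⟨l, hlT, hl⟩ := exists_costate A T (fun s => Cᵀ *ᵥ a s)
  have hLx : ∀ (e : ℕ → Fin n → ℝ) (ξ : Fin n → ℝ),
      L (fun i : Fin (T + 1) => (N * C) *ᵥ olState A B u e ξ i) =
      l 0 ⬝ᵥ ξ + ∑ t : Fin T, l (t + 1) ⬝ᵥ e t + ∑ t : Fin T, l (t + 1) ⬝ᵥ B *ᵥ u t := by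
    intro e ξ
    have h1 := olState_sum A B u e ξ T (fun s => Cᵀ *ᵥ a s) l hl T le_rfl
    rw [hlT] at h1
    simp only [mulVec_zero, zero_dotProduct, add_zero, Finset.sum_range, dotProduct_add,
      Finset.sum_add_distrib] at h1
    rw [hL, add_assoc, add_comm (∑ t : Fin T, l (t + 1) ⬝ᵥ e t), ← h1]
    refine Finset.sum_congr rfl fun i _ => ?_
    have : a i = Nᵀ *ᵥ g i := by
      simp only [a]
      rw [dif_pos i.2]
    rw [this, mulVec_mulVec, ← transpose_mul, dotProduct_mulVec, ← mulVec_transpose]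
  have hext : ∀ {d : ℕ} (w : Fin T → Fin d → ℝ) (i : Fin T), extFin w i = w i := by
    intro d w i
    simp [extFin]
  have hP := kalmanPhat_posDef A C hC Q S0 hS0 hQ
  have hS := fun t => kal_S_posDef C hC _ (hP t)
  simp_rw [hLx, hext]
  rw [prod_charFun γ0 (fun _ => γw) μ0 S0 hS0.posSemidef hγ0 (fun _ => Q)
    (fun _ => hQ.posSemidef) (fun _ => hγw)]
  have hr : ∀ x : (Fin n → ℝ) × (Fin T → Fin q → ℝ),
      l 0 ⬝ᵥ (μ0 + kalmanK A C Q S0 0 *ᵥ (C *ᵥ (x.1 - μ0))) +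
        ∑ t : Fin T, l (t + 1) ⬝ᵥ kalmanK A C Q S0 (t + 1) *ᵥ x.2 t +
        ∑ t : Fin T, l (t + 1) ⬝ᵥ B *ᵥ u t =
      (Cᵀ *ᵥ ((kalmanK A C Q S0 0)ᵀ *ᵥ l 0)) ⬝ᵥ x.1 +
        ∑ t : Fin T, ((kalmanK A C Q S0 (t + 1))ᵀ *ᵥ l (t + 1)) ⬝ᵥ x.2 t +
        (l 0 ⬝ᵥ μ0 - (Cᵀ *ᵥ ((kalmanK A C Q S0 0)ᵀ *ᵥ l 0)) ⬝ᵥ μ0 +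
          ∑ t : Fin T, l (t + 1) ⬝ᵥ B *ᵥ u t) := by
    intro x
    simp only [mulVec_transpose, ← dotProduct_mulVec, mulVec_sub, dotProduct_add, dotProduct_sub]
    ring
  simp_rw [hr]
  rw [prod_charFun γ0 ν μ0 S0 hS0.posSemidef hγ0 _ (fun i => (hS (i + 1)).posSemidef) hν]
  have hE := kal_energy A C hC Q S0 hS0 hQ T a l hl T le_rfl
  rw [hlT, Finset.sum_range_succ'] at hE
  simp only [mulVec_zero, zero_dotProduct, add_zero, Finset.sum_range] at hE
  rw [hE]
  have h0 : (Cᵀ *ᵥ ((kalmanK A C Q S0 0)ᵀ *ᵥ l 0)) ⬝ᵥ S0 *ᵥ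
      (Cᵀ *ᵥ ((kalmanK A C Q S0 0)ᵀ *ᵥ l 0)) =
      ((kalmanK A C Q S0 0)ᵀ *ᵥ l 0) ⬝ᵥ
        (C * kalmanPhat A C Q S0 0 * Cᵀ) *ᵥ ((kalmanK A C Q S0 0)ᵀ *ᵥ l 0) := by
    generalize (kalmanK A C Q S0 0)ᵀ *ᵥ l 0 = y
    rw [kalmanPhat, ← mulVec_mulVec, ← mulVec_mulVec, dotProduct_mulVec y, ← mulVec_transpose]
  rw [h0]
  congr 2
  · congr 2
    ring
  · congr 2
    ring
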